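/- Assume s > 2 and that there exists ε > 0 with q_{i,n} ≥ ε for all i and n. If the set {n ≥ 1 : 1 ≤ a_n ≤ s−2} is infinite, then the value set E_{f_a} has the cardinality of the continuum, is nowhere dense in [0,1], and has Lebesgue measure zero. -/

import Mathlib

open Filter Topology MeasureTheory Set

set_option linter.unusedVariables false

/-- β_{k,n} = Σ_{i<k} q_{i,n}. -/
noncomputable def qbeta (s : ℕ) (q : Fin s → ℕ → ℝ) (k : Fin s) (n : ℕ) : ℝ :=
  ∑ i : Fin s, if i < k then q i n else 0

/-- Δ(α) = β_{α_1,1} + Σ_{n≥2} β_{α_n,n} Π_{j<n} q_{α_j,j}, with positions indexed from 0. -/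
noncomputable def Delta (s : ℕ) (q : Fin s → ℕ → ℝ) (α : ℕ → Fin s) : ℝ :=
  ∑' n : ℕ, qbeta s q (α n) n * ∏ j ∈ Finset.range n, q (α j) j

/-- the digit |a − b|. -/
def adiff {s : ℕ} (a b : Fin s) : Fin s :=
  ⟨a.1 - b.1 + (b.1 - a.1), by have ha := a.2; have hb := b.2; omega⟩

section QStar

variable {s : ℕ} {q : Fin s → ℕ → ℝ}

lemma qbeta_nonneg (hq0 : ∀ i n, 0 < q i n) (k : Fin s) (n : ℕ) : 0 ≤ qbeta s q k n :=
  Finset.sum_nonneg fun i _ => by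
    split_ifs
    exacts [(hq0 i n).le, le_rfl]

lemma qbeta_add_self (k : Fin s) (n : ℕ) :
    qbeta s q k n + q k n = ∑ i : Fin s, if i ≤ k then q i n else 0 := by
  rw [qbeta, ← Fintype.sum_ite_eq' k (fun i => q i n), ← Finset.sum_add_distrib]
  refine Finset.sum_congr rfl fun i _ => ?_
  rcases lt_trichotomy i k with h | h | h
  · simp [h, h.le, h.ne]
  · simp [h]
  · simp [h.not_gt, h.not_ge, h.ne']

lemma qbeta_add_self_le_qbeta (hq0 : ∀ i n, 0 < q i n) {k l : Fin s} (h : k < l) (n : ℕ) :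
    qbeta s q k n + q k n ≤ qbeta s q l n := by
  rw [qbeta_add_self, qbeta]
  refine Finset.sum_le_sum fun i _ => ?_
  by_cases hi : i ≤ k
  · simp [hi, hi.trans_lt h]
  · rw [if_neg hi]
    split_ifs
    exacts [(hq0 i n).le, le_rfl]

lemma qbeta_add_self_le_one (hq0 : ∀ i n, 0 < q i n) (hqsum : ∀ n, ∑ i : Fin s, q i n = 1)
    (k : Fin s) (n : ℕ) : qbeta s q k n + q k n ≤ 1 := by
  rw [qbeta_add_self, ← hqsum n]
  refine Finset.sum_le_sum fun i _ => ?_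
  split_ifs
  exacts [le_rfl, (hq0 i n).le]

lemma qbeta_add_self_lt_one (hq0 : ∀ i n, 0 < q i n) (hqsum : ∀ n, ∑ i : Fin s, q i n = 1)
    {k l : Fin s} (h : k < l) (n : ℕ) : qbeta s q k n + q k n < 1 := by
  linarith [qbeta_add_self_le_qbeta hq0 h n, qbeta_add_self_le_one hq0 hqsum l n, hq0 l n]

lemma Delta_term_nonneg (hq0 : ∀ i n, 0 < q i n) (α : ℕ → Fin s) (n : ℕ) :
    0 ≤ qbeta s q (α n) n * ∏ j ∈ Finset.range n, q (α j) j :=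
  mul_nonneg (qbeta_nonneg hq0 _ _) (Finset.prod_nonneg fun _ _ => (hq0 _ _).le)

lemma Delta_partial_sum_le (hq0 : ∀ i n, 0 < q i n) (hqsum : ∀ n, ∑ i : Fin s, q i n = 1)
    (α : ℕ → Fin s) (N : ℕ) :
    ∑ n ∈ Finset.range N, qbeta s q (α n) n * ∏ j ∈ Finset.range n, q (α j) j ≤
      1 - ∏ j ∈ Finset.range N, q (α j) j := by
  induction N with
  | zero => simp
  | succ N ih =>
    rw [Finset.sum_range_succ, Finset.prod_range_succ]
    have hP : 0 ≤ ∏ j ∈ Finset.range N, q (α j) j := Finset.prod_nonneg fun _ _ => (hq0 _ _).le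
    nlinarith [qbeta_add_self_le_one hq0 hqsum (α N) N]

lemma Delta_partial_sum_le_one (hq0 : ∀ i n, 0 < q i n) (hqsum : ∀ n, ∑ i : Fin s, q i n = 1)
    (α : ℕ → Fin s) (N : ℕ) :
    ∑ n ∈ Finset.range N, qbeta s q (α n) n * ∏ j ∈ Finset.range n, q (α j) j ≤ 1 :=
  (Delta_partial_sum_le hq0 hqsum α N).trans
    (sub_le_self _ (Finset.prod_nonneg fun _ _ => (hq0 _ _).le))

lemma summable_Delta (hq0 : ∀ i n, 0 < q i n) (hqsum : ∀ n, ∑ i : Fin s, q i n = 1)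
    (α : ℕ → Fin s) :
    Summable fun n => qbeta s q (α n) n * ∏ j ∈ Finset.range n, q (α j) j :=
  summable_of_sum_range_le (Delta_term_nonneg hq0 α) (Delta_partial_sum_le_one hq0 hqsum α)

lemma Delta_mem_Icc (hq0 : ∀ i n, 0 < q i n) (hqsum : ∀ n, ∑ i : Fin s, q i n = 1)
    (α : ℕ → Fin s) : Delta s q α ∈ Icc (0 : ℝ) 1 :=
  ⟨tsum_nonneg (Delta_term_nonneg hq0 α),
    Real.tsum_le_of_sum_range_le (Delta_term_nonneg hq0 α) (Delta_partial_sum_le_one hq0 hqsum α)⟩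

lemma Delta_eq_add_mul (hq0 : ∀ i n, 0 < q i n) (hqsum : ∀ n, ∑ i : Fin s, q i n = 1)
    (α : ℕ → Fin s) :
    Delta s q α = qbeta s q (α 0) 0 +
      q (α 0) 0 * Delta s (fun i n => q i (n + 1)) (fun n => α (n + 1)) := by
  rw [Delta, (summable_Delta hq0 hqsum α).tsum_eq_zero_add, Delta, ← tsum_mul_left]
  congr 1
  · simp
  · refine tsum_congr fun n => ?_
    rw [Finset.prod_range_succ']
    simp only [qbeta]
    ring

lemma Delta_lt_of_lt (hq0 : ∀ i n, 0 < q i n) (hqsum : ∀ n, ∑ i : Fin s, q i n = 1)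
    {α γ : ℕ → Fin s} {l : Fin s} (hl : α 1 < l) (h : α 0 < γ 0) :
    Delta s q α < Delta s q γ := by
  have h0' : ∀ i n, 0 < q i (n + 1) := fun i n => hq0 i (n + 1)
  have hs' : ∀ n, ∑ i : Fin s, q i (n + 1) = 1 := fun n => hqsum (n + 1)
  have key : Delta s (fun i n => q i (n + 1)) (fun n => α (n + 1)) < 1 := by
    rw [Delta_eq_add_mul h0' hs']
    have h1 := qbeta_add_self_lt_one h0' hs' hl 0
    have h2 := (Delta_mem_Icc (q := fun i n => q i (n + 1 + 1)) (fun i n => hq0 i _)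
      (fun n => hqsum _) (fun n => α (n + 1 + 1))).2
    have h3 := h0' (α 1) 0
    simp only [zero_add] at h1 h2 h3 ⊢
    nlinarith
  rw [Delta_eq_add_mul hq0 hqsum α, Delta_eq_add_mul hq0 hqsum γ]
  have h1 := qbeta_add_self_le_qbeta hq0 h 0
  have h2 := mul_nonneg (hq0 (γ 0) 0).le (Delta_mem_Icc h0' hs' (fun n => γ (n + 1))).1
  have h3 := mul_lt_mul_of_pos_left key (hq0 (α 0) 0)
  linarith

lemma digit_zero_eq_of_Delta_eq (hq0 : ∀ i n, 0 < q i n) (hqsum : ∀ n, ∑ i : Fin s, q i n = 1)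
    {l : Fin s} {α γ : ℕ → Fin s} (hα : α 1 < l) (hγ : γ 1 < l)
    (h : Delta s q α = Delta s q γ) : α 0 = γ 0 := by
  rcases lt_trichotomy (α 0) (γ 0) with hlt | heq | hgt
  · exact absurd h (Delta_lt_of_lt hq0 hqsum hα hlt).ne
  · exact heq
  · exact absurd h (Delta_lt_of_lt hq0 hqsum hγ hgt).ne'

/-- The map `Δ` is injective on the sequences whose digits stay below a fixed digit. -/
lemma digit_eq_of_Delta_eq (hq0 : ∀ i n, 0 < q i n) (hqsum : ∀ n, ∑ i : Fin s, q i n = 1)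
    {l : Fin s} {α γ : ℕ → Fin s} (hα : ∀ n, α n < l) (hγ : ∀ n, γ n < l)
    (h : Delta s q α = Delta s q γ) (n : ℕ) : α n = γ n := by
  have h0 := digit_zero_eq_of_Delta_eq hq0 hqsum (hα 1) (hγ 1) h
  induction n generalizing q α γ with
  | zero => exact h0
  | succ n ih =>
    have h' : Delta s (fun i n => q i (n + 1)) (fun n => α (n + 1)) =
        Delta s (fun i n => q i (n + 1)) (fun n => γ (n + 1)) := by
      rw [Delta_eq_add_mul hq0 hqsum α, Delta_eq_add_mul hq0 hqsum γ, h0] at h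
      exact mul_left_cancel₀ (hq0 _ _).ne' (add_left_cancel h)
    have hq0' : ∀ i n, 0 < q i (n + 1) := fun i n => hq0 i (n + 1)
    have hqsum' : ∀ n, ∑ i : Fin s, q i (n + 1) = 1 := fun n => hqsum (n + 1)
    exact ih hq0' hqsum' (fun n => hα (n + 1)) (fun n => hγ (n + 1)) h'
      (digit_zero_eq_of_Delta_eq hq0' hqsum' (hα 2) (hγ 2) h')

/-- The values of the representation that starts at position `k` and whose digit at position `n`
belongs to `D n`. -/
def tailValues (q : Fin s → ℕ → ℝ) (D : ℕ → Finset (Fin s)) (k : ℕ) : Set ℝ :=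
  {y | ∃ γ : ℕ → Fin s, (∀ n, γ n ∈ D (n + k)) ∧ y = Delta s (fun i n => q i (n + k)) γ}

lemma tailValues_subset_Icc (hq0 : ∀ i n, 0 < q i n) (hqsum : ∀ n, ∑ i : Fin s, q i n = 1)
    (D : ℕ → Finset (Fin s)) (k : ℕ) : tailValues q D k ⊆ Icc 0 1 := by
  rintro _ ⟨γ, -, rfl⟩
  exact Delta_mem_Icc (fun i n => hq0 i (n + k)) (fun n => hqsum (n + k)) γ

lemma closure_tailValues_subset_Icc (hq0 : ∀ i n, 0 < q i n)
    (hqsum : ∀ n, ∑ i : Fin s, q i n = 1) (D : ℕ → Finset (Fin s)) (k : ℕ) :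
    closure (tailValues q D k) ⊆ Icc 0 1 :=
  closure_minimal (tailValues_subset_Icc hq0 hqsum D k) isClosed_Icc

lemma closure_tailValues_subset (hq0 : ∀ i n, 0 < q i n) (hqsum : ∀ n, ∑ i : Fin s, q i n = 1)
    (D : ℕ → Finset (Fin s)) (k : ℕ) :
    closure (tailValues q D k) ⊆
      ⋃ i ∈ D k, (fun x => qbeta s q i k + q i k * x) '' closure (tailValues q D (k + 1)) := by
  refine closure_minimal ?_ ?_
  · rintro _ ⟨γ, hγ, rfl⟩
    simp only [mem_iUnion]
    refine ⟨γ 0, by simpa using hγ 0, _,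
      subset_closure ⟨fun n => γ (n + 1), fun n => ?_, rfl⟩, ?_⟩
    · have := hγ (n + 1)
      rwa [show n + 1 + k = n + (k + 1) by ring] at this
    · rw [Delta_eq_add_mul (fun i n => hq0 i (n + k)) (fun n => hqsum (n + k)) γ]
      simp [qbeta, show ∀ n, n + 1 + k = n + (k + 1) from fun n => by ring]
  · refine (D k).finite_toSet.isClosed_biUnion fun i _ => ?_
    have hc : IsCompact (closure (tailValues q D (k + 1))) :=
      isCompact_Icc.of_isClosed_subset isClosed_closure
        (closure_tailValues_subset_Icc hq0 hqsum D (k + 1))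
    exact (hc.image (by fun_prop)).isClosed

lemma volume_image_add_mul (b c : ℝ) (hc : 0 ≤ c) (S : Set ℝ) :
    volume ((fun x => b + c * x) '' S) = ENNReal.ofReal c * volume S := by
  have : (fun x => b + c * x) '' S = (fun x => b + x) '' ((fun x => c • x) '' S) := by
    simp [image_image]
  rw [this, image_add_left, measure_preimage_add, image_smul, Measure.addHaar_smul]
  simp [abs_of_nonneg hc]

lemma volume_closure_tailValues_le (hq0 : ∀ i n, 0 < q i n)
    (hqsum : ∀ n, ∑ i : Fin s, q i n = 1) (D : ℕ → Finset (Fin s)) (k : ℕ) :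
    volume (closure (tailValues q D k)) ≤
      ENNReal.ofReal (∑ i ∈ D k, q i k) * volume (closure (tailValues q D (k + 1))) := by
  refine (measure_mono (closure_tailValues_subset hq0 hqsum D k)).trans
    ((measure_biUnion_finset_le _ _).trans_eq ?_)
  rw [ENNReal.ofReal_sum_of_nonneg fun i _ => (hq0 i k).le, Finset.sum_mul]
  exact Finset.sum_congr rfl fun i _ => volume_image_add_mul _ _ (hq0 i k).le _

lemma volume_closure_tailValues_eq_zero (hq0 : ∀ i n, 0 < q i n)
    (hqsum : ∀ n, ∑ i : Fin s, q i n = 1) {ε : ℝ} (hε : 0 < ε) (hqε : ∀ i n, ε ≤ q i n)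
    (D : ℕ → Finset (Fin s)) (hD : {n | D n ≠ Finset.univ}.Infinite) (k : ℕ) :
    volume (closure (tailValues q D k)) = 0 := by
  set v : ℕ → ENNReal := fun k => volume (closure (tailValues q D k)) with hv
  have hle : ∀ k, v k ≤ v (k + 1) := fun k => by
    refine (volume_closure_tailValues_le hq0 hqsum D k).trans (mul_le_of_le_one_left' ?_)
    rw [← ENNReal.ofReal_one, ← hqsum k]
    exact ENNReal.ofReal_le_ofReal
      (Finset.sum_le_univ_sum_of_nonneg fun i => (hq0 i k).le)
  have hmono : Monotone v := monotone_nat_of_le_succ hle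
  have hstep : ∀ k, D k ≠ Finset.univ → v k ≤ ENNReal.ofReal (1 - ε) * v (k + 1) := by
    intro k hk
    refine (volume_closure_tailValues_le hq0 hqsum D k).trans ?_
    gcongr
    obtain ⟨i, hi⟩ : ∃ i, i ∉ D k := by
      by_contra! h
      exact hk (Finset.eq_univ_iff_forall.2 h)
    have := Finset.sum_le_univ_sum_of_nonneg (s := insert i (D k)) fun j => (hq0 j k).le
    rw [Finset.sum_insert hi, hqsum k] at this
    linarith [hqε i k]
  have hpow : ∀ n k, v k ≤ ENNReal.ofReal (1 - ε) ^ n := by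
    intro n
    induction n with
    | zero =>
      intro k
      simpa using measure_mono (μ := volume) (closure_tailValues_subset_Icc hq0 hqsum D k)
    | succ n ih =>
      intro k
      obtain ⟨m, hm, hkm⟩ := hD.exists_gt k
      rw [pow_succ']
      calc v k ≤ v m := hmono hkm.le
        _ ≤ ENNReal.ofReal (1 - ε) * v (m + 1) := hstep m hm
        _ ≤ _ := by gcongr; exact ih _
  have hlim := ENNReal.tendsto_pow_atTop_nhds_zero_of_lt_one
    (r := ENNReal.ofReal (1 - ε)) (by rw [ENNReal.ofReal_lt_one]; linarith)
  exact le_antisymm (ge_of_tendsto' hlim fun n => hpow n k) zero_le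

lemma exists_adiff_eq (hs : 2 < s) (a : Fin s) (b : Bool) :
    ∃ c : Fin s, (adiff a c).1 = b.toNat := by
  have ha := a.2
  cases b with
  | false => exact ⟨a, by simp [adiff]⟩
  | true =>
    rcases Nat.eq_zero_or_pos a.1 with h | h
    · exact ⟨⟨1, by omega⟩, by simp [adiff, h]⟩
    · exact ⟨⟨a.1 - 1, by omega⟩, by simp only [adiff, Bool.toNat_true]; omega⟩

lemma adiff_ne_last {a : Fin s} (h1 : 1 ≤ a.1) (h2 : a.1 ≤ s - 2) (c : Fin s) :
    (adiff a c).1 ≠ s - 1 := by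
  have := c.2
  simp only [adiff]
  omega

lemma mk_adiff_values (hs : 2 < s) (hq0 : ∀ i n, 0 < q i n)
    (hqsum : ∀ n, ∑ i : Fin s, q i n = 1) (aseq : ℕ → Fin s) :
    Cardinal.mk ↥{y : ℝ | ∃ α : ℕ → Fin s, y = Delta s q (fun n => adiff (aseq n) (α n))} =
      Cardinal.continuum := by
  refine le_antisymm ((Cardinal.mk_set_le _).trans_eq Cardinal.mk_real) ?_
  choose c hc using fun n => exists_adiff_eq hs (aseq n)
  have hlt : ∀ (b : ℕ → Bool) n, adiff (aseq n) (c n (b n)) < ⟨2, hs⟩ := fun b n => by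
    rw [Fin.lt_def, hc]
    exact Nat.lt_succ_of_le (Bool.toNat_le _)
  have hinj : Function.Injective fun b : ℕ → Bool =>
      (⟨_, fun n => c n (b n), rfl⟩ :
        {y : ℝ | ∃ α : ℕ → Fin s, y = Delta s q (fun n => adiff (aseq n) (α n))}) := by
    intro b b' h
    funext n
    have := congrArg Fin.val
      (digit_eq_of_Delta_eq hq0 hqsum (hlt b) (hlt b') (congrArg Subtype.val h) n)
    rw [hc, hc] at this
    revert this
    cases b n <;> cases b' n <;> simp
  have hmk : Cardinal.mk (ℕ → Bool) = Cardinal.continuum := by simp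
  exact hmk ▸ Cardinal.mk_le_of_injective hinj

end QStar

/-- if s > 2, the q_{i,n} are bounded below by ε > 0, and a_n ∈ {1,…,s−2}
for infinitely many n, then E_{f_a} has cardinality continuum, is nowhere dense, and has
Lebesgue measure zero. -/
theorem stmt15 (s : ℕ) (hs : 2 ≤ s) (q : Fin s → ℕ → ℝ)
    (hq0 : ∀ i n, 0 < q i n) (hq1 : ∀ i n, q i n < 1)
    (hqsum : ∀ n, ∑ i : Fin s, q i n = 1)
    (hqprod : Filter.Tendsto (fun N => ∏ n ∈ Finset.range N, ⨆ i : Fin s, q i n)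
      Filter.atTop (nhds 0))
    (hs' : 2 < s)
    (ε : ℝ) (hε : 0 < ε) (hqε : ∀ i n, ε ≤ q i n)
    (a : ℝ) (ha : a ∈ Set.Icc (0 : ℝ) 1) (aseq : ℕ → Fin s)
    (haseq : a = ∑' n : ℕ, (aseq n : ℝ) / (s : ℝ) ^ (n + 1))
    (hinf : {n : ℕ | 1 ≤ (aseq n).1 ∧ (aseq n).1 ≤ s - 2}.Infinite) :
    Cardinal.mk
        ↥{y : ℝ | ∃ α : ℕ → Fin s, y = Delta s q (fun n => adiff (aseq n) (α n))} =
        Cardinal.continuum ∧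
      IsNowhereDense
        {y : ℝ | ∃ α : ℕ → Fin s, y = Delta s q (fun n => adiff (aseq n) (α n))} ∧
      MeasureTheory.volume
        {y : ℝ | ∃ α : ℕ → Fin s, y = Delta s q (fun n => adiff (aseq n) (α n))} = 0 := by
  set E := {y : ℝ | ∃ α : ℕ → Fin s, y = Delta s q (fun n => adiff (aseq n) (α n))} with hE
  let D : ℕ → Finset (Fin s) := fun n => Finset.univ.image (adiff (aseq n))
  have hsub : E ⊆ tailValues q D 0 := by
    rintro _ ⟨α, rfl⟩
    exact ⟨_, fun n => Finset.mem_image_of_mem _ (Finset.mem_univ _), rfl⟩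
  have hD : {n | D n ≠ Finset.univ}.Infinite := by
    refine hinf.mono fun n hn h => ?_
    have hmem : (⟨s - 1, by omega⟩ : Fin s) ∈ D n := h ▸ Finset.mem_univ _
    obtain ⟨c, -, hc⟩ := Finset.mem_image.1 hmem
    exact adiff_ne_last hn.1 hn.2 c (congrArg Fin.val hc)
  have hzero : volume (closure E) = 0 :=
    measure_mono_null (closure_mono hsub)
      (volume_closure_tailValues_eq_zero hq0 hqsum hε hqε D hD 0)
  exact ⟨mk_adiff_values hs' hq0 hqsum aseq, Measure.interior_eq_empty_of_null hzero,
    measure_mono_null subset_closure hzero⟩
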